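/- Let f(t₁,…,t_d) be an ℝ-valued infinitely differentiable function on an open subset of ℝᵈ on which t_j ≠ 0. Then for every n ∈ ℕ, D_{t_j}(n){∂_{t_j} f} − ∂_{t_j} D^{t_j}(n){f} = (2n/t_j) D^{t_j}(n){f}. -/

import Mathlib

noncomputable section

/-- The partial derivative `∂_{t_j}` of `f : ℝᵈ → ℝ`. -/
def pdj (d : ℕ) (j : Fin d) (f : (Fin d → ℝ) → ℝ) : (Fin d → ℝ) → ℝ :=
  fun t => fderiv ℝ f t (Pi.single j 1)

/-- The operator `D_{t_j}(n)`: `D_{t_j}(0){f} = f`,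
`D_{t_j}(n+1){f} = (1/t_j) ∂_{t_j}(D_{t_j}(n){f})`. -/
def DlowJ (d : ℕ) (j : Fin d) : ℕ → ((Fin d → ℝ) → ℝ) → ((Fin d → ℝ) → ℝ)
  | 0, f => f
  | n + 1, f => fun t => (t j)⁻¹ * pdj d j (DlowJ d j n f) t

/-- The operator `D^{t_j}(n)`: `D^{t_j}(0){f} = f`,
`D^{t_j}(n){f} = ∂_{t_j}(D^{t_j}(n-1){f} / t_j)`. -/
def DupJ (d : ℕ) (j : Fin d) : ℕ → ((Fin d → ℝ) → ℝ) → ((Fin d → ℝ) → ℝ)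
  | 0, f => f
  | n + 1, f => pdj d j (fun t => DupJ d j n f t / t j)

lemma pdj_congr_on {d : ℕ} {j : Fin d} {U : Set (Fin d → ℝ)} (hU : IsOpen U)
    {f g : (Fin d → ℝ) → ℝ} (h : ∀ t ∈ U, f t = g t) :
    ∀ t ∈ U, pdj d j f t = pdj d j g t := by
  intro t ht
  have : f =ᶠ[nhds t] g := Filter.eventuallyEq_of_mem (hU.mem_nhds ht) h
  simp only [pdj, this.fderiv_eq]

lemma ContDiffOn.pdj {d : ℕ} {j : Fin d} {U : Set (Fin d → ℝ)} (hU : IsOpen U)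
    {f : (Fin d → ℝ) → ℝ} (hf : ContDiffOn ℝ (⊤ : ℕ∞) f U) :
    ContDiffOn ℝ (⊤ : ℕ∞) (pdj d j f) U :=
  (hf.fderiv_of_isOpen hU (m := (⊤ : ℕ∞)) (by simp)).clm_apply contDiffOn_const

lemma ContDiffOn.div_coord {d : ℕ} {j : Fin d} {U : Set (Fin d → ℝ)}
    (hUj : ∀ t ∈ U, t j ≠ 0) {f : (Fin d → ℝ) → ℝ} (hf : ContDiffOn ℝ (⊤ : ℕ∞) f U) :
    ContDiffOn ℝ (⊤ : ℕ∞) (fun t => f t / t j) U :=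
  hf.div (contDiff_apply ℝ ℝ j).contDiffOn hUj

lemma ContDiffOn.DupJ {d : ℕ} {j : Fin d} {U : Set (Fin d → ℝ)} (hU : IsOpen U)
    (hUj : ∀ t ∈ U, t j ≠ 0) {f : (Fin d → ℝ) → ℝ} (hf : ContDiffOn ℝ (⊤ : ℕ∞) f U) (n : ℕ) :
    ContDiffOn ℝ (⊤ : ℕ∞) (DupJ d j n f) U := by
  induction n with
  | zero => exact hf
  | succ n ih => exact (ih.div_coord hUj).pdj hU

lemma ContDiffOn.differentiableAt_of_isOpen {d : ℕ} {U : Set (Fin d → ℝ)} (hU : IsOpen U)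
    {f : (Fin d → ℝ) → ℝ} (hf : ContDiffOn ℝ (⊤ : ℕ∞) f U) {t : Fin d → ℝ} (ht : t ∈ U) :
    DifferentiableAt ℝ f t :=
  (hf.contDiffAt (hU.mem_nhds ht)).differentiableAt (by simp)

lemma pdj_add {d : ℕ} {j : Fin d} {f g : (Fin d → ℝ) → ℝ} {t : Fin d → ℝ}
    (hf : DifferentiableAt ℝ f t) (hg : DifferentiableAt ℝ g t) :
    pdj d j (fun s => f s + g s) t = pdj d j f t + pdj d j g t := by
  simp [pdj, fderiv_fun_add hf hg]

lemma pdj_const_mul {d : ℕ} {j : Fin d} {f : (Fin d → ℝ) → ℝ} {t : Fin d → ℝ}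
    (hf : DifferentiableAt ℝ f t) (c : ℝ) :
    pdj d j (fun s => c * f s) t = c * pdj d j f t := by
  simp [pdj, fderiv_const_mul hf c]

lemma pdj_coord_mul {d : ℕ} {j : Fin d} {f : (Fin d → ℝ) → ℝ} {t : Fin d → ℝ}
    (hf : DifferentiableAt ℝ f t) :
    pdj d j (fun s => s j * f s) t = f t + t j * pdj d j f t := by
  have h := (hasFDerivAt_apply (𝕜 := ℝ) j t).fun_mul hf.hasFDerivAt
  simp [pdj, h.fderiv, add_comm]

/-- **Lemma 1 (iv):** `D_{t_j}(n){∂_{t_j} f} − ∂_{t_j} D^{t_j}(n){f} = (2n/t_j) D^{t_j}(n){f}`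
for a smooth function `f` on an open set where `t_j ≠ 0`. -/
theorem lemma1_iv (d : ℕ) (j : Fin d) (U : Set (Fin d → ℝ)) (hU : IsOpen U)
    (hUj : ∀ t ∈ U, t j ≠ 0) (f : (Fin d → ℝ) → ℝ) (hf : ContDiffOn ℝ (⊤ : ℕ∞) f U) (n : ℕ) :
    ∀ t ∈ U, DlowJ d j n (pdj d j f) t - pdj d j (DupJ d j n f) t
      = (2 * n : ℝ) / t j * DupJ d j n f t := by
  induction n with
  | zero => simp [DlowJ, DupJ]
  | succ n ih =>
    intro t ht
    have htj := hUj t ht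
    set g := DupJ d j n f with hg
    set u : (Fin d → ℝ) → ℝ := fun s => g s / s j with hu
    have hu_smooth : ContDiffOn ℝ (⊤ : ℕ∞) u U := (hf.DupJ hU hUj n).div_coord hUj
    have hu_diff : ∀ s ∈ U, DifferentiableAt ℝ u s :=
      fun s hs => hu_smooth.differentiableAt_of_isOpen hU hs
    have hu'_diff : ∀ s ∈ U, DifferentiableAt ℝ (pdj d j u) s :=
      fun s hs => (hu_smooth.pdj hU).differentiableAt_of_isOpen hU hs
    have hg_eq : ∀ s ∈ U, g s = s j * u s := fun s hs => by
      have := hUj s hs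
      simp only [hu]
      field_simp
    have hlow : ∀ s ∈ U, DlowJ d j n (pdj d j f) s
        = (2 * n + 1 : ℝ) * u s + s j * pdj d j u s := fun s hs => by
      have h := ih s hs
      rw [pdj_congr_on hU hg_eq s hs, pdj_coord_mul (hu_diff s hs), hg_eq s hs] at h
      have := hUj s hs
      field_simp at h
      linarith
    have hlow' : pdj d j (DlowJ d j n (pdj d j f)) t
        = (2 * n + 2 : ℝ) * pdj d j u t + t j * pdj d j (pdj d j u) t := by
      rw [pdj_congr_on hU hlow t ht, pdj_add ((hu_diff t ht).const_mul _)
        ((differentiableAt_apply j t).fun_mul (hu'_diff t ht)),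
        pdj_const_mul (hu_diff t ht), pdj_coord_mul (hu'_diff t ht)]
      ring
    change (t j)⁻¹ * pdj d j (DlowJ d j n (pdj d j f)) t - pdj d j (pdj d j u) t
      = (2 * (n + 1 : ℕ) : ℝ) / t j * pdj d j u t
    rw [hlow']
    push_cast
    field_simp
    ring
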